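/- Let G be a locally compact Hausdorff topological group with a left Haar measure dx and let K be a compact subgroup with normalized Haar measure dk. Let φ : G → ℂ be a continuous bounded function satisfying ∫_K φ(x k y) dk = φ(x) φ(y) for all x, y ∈ G, and let ρ : G → ℂ be continuous with compact support. Then for every x ∈ G: φ(x) · ∫_G φ(y) ρ(y) dy = ∫_G ( ∫_K ρ(k⁻¹ x⁻¹ y) dk ) φ(y) dy. -/

import Mathlib

open MeasureTheory Topology Filter

/-- Let `G` be a locally compact Hausdorff topological group with a left Haar
measure `μ` and `K` a compact subgroup with normalized Haar measure `ν`. Let `φ : G → ℂ` be a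
continuous bounded function satisfying `∫_K φ (x * k * y) dk = φ x * φ y` for all `x y`, and let
`ρ : G → ℂ` be continuous with compact support. Then for every `x`:
`φ x * ∫_G φ y * ρ y dy = ∫_G (∫_K ρ (k⁻¹ * x⁻¹ * y) dk) * φ y dy`. -/
theorem spherical_convolution_identity
    {G : Type*} [Group G] [TopologicalSpace G] [IsTopologicalGroup G]
    [LocallyCompactSpace G] [T2Space G] [MeasurableSpace G] [BorelSpace G]
    (μ : Measure G) [μ.IsHaarMeasure]
    (K : Subgroup G) [CompactSpace K] (ν : Measure K) [ν.IsHaarMeasure]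
    [IsProbabilityMeasure ν]
    (φ : G → ℂ) (hcont : Continuous φ) (hbdd : ∃ C : ℝ, ∀ x, ‖φ x‖ ≤ C)
    (hsph : ∀ x y : G, (∫ k : K, φ (x * (k : G) * y) ∂ν) = φ x * φ y)
    (ρ : G → ℂ) (hρcont : Continuous ρ) (hρsupp : HasCompactSupport ρ) :
    ∀ x : G, φ x * ∫ y, φ y * ρ y ∂μ
      = ∫ y, (∫ k : K, ρ ((k : G)⁻¹ * x⁻¹ * y) ∂ν) * φ y ∂μ := by
  intro x
  have h1 : ∫ y, (∫ k : K, ρ ((k : G)⁻¹ * x⁻¹ * y) ∂ν) * φ y ∂μ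
      = ∫ y, (∫ k : K, ρ ((k : G)⁻¹ * x⁻¹ * y) * φ y ∂ν) ∂μ := by
    congr 1 with y
    rw [integral_mul_const]
  have h2 : ∫ y, (∫ k : K, ρ ((k : G)⁻¹ * x⁻¹ * y) * φ y ∂ν) ∂μ
      = ∫ k : K, (∫ y, ρ ((k : G)⁻¹ * x⁻¹ * y) * φ y ∂μ) ∂ν := by
    apply integral_integral_swap_of_hasCompactSupport
    · simp only [Function.uncurry_def]
      fun_prop
    · have hc : IsCompact ((fun p : K × G => (x * (p.1 : G) * p.2, p.1)) ''
          (Set.univ ×ˢ tsupport ρ)) :=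
        (isCompact_univ.prod hρsupp).image (by fun_prop)
      refine HasCompactSupport.intro hc ?_
      rintro ⟨y, k⟩ h
      have : ρ ((k : G)⁻¹ * x⁻¹ * y) = 0 := by
        apply image_eq_zero_of_notMem_tsupport
        intro h'
        refine h ⟨(k, (k : G)⁻¹ * x⁻¹ * y), ⟨Set.mem_univ _, h'⟩, ?_⟩
        simp [mul_assoc]
      simp [Function.uncurry, this]
  have h3 : ∀ k : K, ∫ y, ρ ((k : G)⁻¹ * x⁻¹ * y) * φ y ∂μ
      = ∫ y, φ (x * (k : G) * y) * ρ y ∂μ := by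
    intro k
    rw [← integral_mul_left_eq_self (fun y => ρ ((k : G)⁻¹ * x⁻¹ * y) * φ y) (x * (k : G))]
    congr 1 with y
    rw [mul_comm]
    congr 2
    group
  have h4 : ∫ k : K, (∫ y, φ (x * (k : G) * y) * ρ y ∂μ) ∂ν
      = ∫ y, (∫ k : K, φ (x * (k : G) * y) * ρ y ∂ν) ∂μ := by
    apply integral_integral_swap_of_hasCompactSupport
    · simp only [Function.uncurry_def]
      fun_prop
    · refine HasCompactSupport.intro (isCompact_univ.prod hρsupp) ?_
      rintro ⟨k, y⟩ h
      have : ρ y = 0 := by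
        apply image_eq_zero_of_notMem_tsupport
        intro h'
        exact h ⟨Set.mem_univ _, h'⟩
      simp [Function.uncurry, this]
  rw [h1, h2]
  simp_rw [h3]
  rw [h4, ← integral_const_mul]
  congr 1 with y
  rw [integral_mul_const, hsph, mul_assoc]
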